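/- arXiv:2605.08745 — 2 statements merged into one kernel-verified Lean document; each statement's English description precedes it below -/
import Mathlib

section
/- Let m be a prime, n ≥ 1 an integer, and f : (ZMod m)^n → ℂ a function such that for every mask r (vector in (ZMod m)^n with at least two nonzero coordinates) and all k, k′ ∈ ZMod m, Σ_{x : r·x = k} f(x) = Σ_{x : r·x = k′} f(x). Then there exist a constant c ∈ ℂ and functions g_1,…,g_n : ZMod m → ℂ such that f(x) = c + Σ_{i=1}^{n} g_i(x_i) for every x ∈ (ZMod m)^n. -/
open Finset

open ZMod AddChar in
/-- Orthogonality of the additive characters `r ↦ e(r·z)` on `(ZMod m)^n`. -/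
lemma sum_stdAddChar_dot (m n : ℕ) [NeZero m] (z : Fin n → ZMod m) :
    ∑ r : Fin n → ZMod m, stdAddChar (∑ i, r i * z i) = if z = 0 then (m : ℂ) ^ n else 0 := by
  have h1 (t : ZMod m) : ∑ s : ZMod m, stdAddChar (s * t) = if t = 0 then (m : ℂ) else 0 := by
    simp_rw [mul_comm _ t]
    split_ifs with h
    · simp [h, ZMod.card]
    · exact sum_eq_zero_of_ne_one (isPrimitive_stdAddChar m h)
  have h2 (r : Fin n → ZMod m) :
      stdAddChar (∑ i, r i * z i) = ∏ i, (stdAddChar (r i * z i) : ℂ) :=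
    (map_prod (toMonoidHom stdAddChar) (fun i => Multiplicative.ofAdd (r i * z i)) univ :)
  simp_rw [h2]
  rw [← Fintype.prod_sum (fun i s => (stdAddChar (s * z i) : ℂ))]
  simp_rw [h1]
  split_ifs with h
  · simp [h]
  · obtain ⟨i, hi⟩ := Function.ne_iff.mp h
    exact prod_eq_zero (mem_univ i) (if_neg hi)

open ZMod in
/-- Fourier inversion on `(ZMod m)^n`. -/
lemma fourier_inversion_dot (m n : ℕ) [NeZero m] (f : (Fin n → ZMod m) → ℂ)
    (y : Fin n → ZMod m) :
    ∑ r : Fin n → ZMod m,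
      stdAddChar (-∑ i, r i * y i) * ∑ x : Fin n → ZMod m, stdAddChar (∑ i, r i * x i) * f x =
      (m : ℂ) ^ n * f y := by
  have h (r x : Fin n → ZMod m) :
      (stdAddChar (-∑ i, r i * y i) * (stdAddChar (∑ i, r i * x i) * f x) : ℂ) =
        stdAddChar (∑ i, r i * (x - y) i) * f x := by
    rw [← mul_assoc, ← AddChar.map_add_eq_mul]
    simp only [Pi.sub_apply, mul_sub, sum_sub_distrib]
    rw [neg_add_eq_sub]
  simp_rw [mul_sum, h]
  rw [sum_comm]
  simp_rw [← sum_mul, sum_stdAddChar_dot, sub_eq_zero]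
  simp

open ZMod in
/-- If `f` has equal sums over the classes `{x : r·x = k}`, its Fourier coefficient at `r`
vanishes. -/
lemma fourier_coeff_eq_zero (m n : ℕ) [NeZero m] (hm : 1 < m) (f : (Fin n → ZMod m) → ℂ)
    (r : Fin n → ZMod m)
    (hr : ∀ k k' : ZMod m,
      ∑ x ∈ univ.filter (fun x : Fin n → ZMod m => ∑ i, r i * x i = k), f x =
      ∑ x ∈ univ.filter (fun x : Fin n → ZMod m => ∑ i, r i * x i = k'), f x) :
    ∑ x : Fin n → ZMod m, stdAddChar (∑ i, r i * x i) * f x = 0 := by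
  have : Fact (1 < m) := ⟨hm⟩
  rw [← sum_fiberwise univ (fun x : Fin n → ZMod m => ∑ i, r i * x i)]
  have h (k : ZMod m) :
      ∑ x ∈ univ.filter (fun x : Fin n → ZMod m => ∑ i, r i * x i = k),
        stdAddChar (∑ i, r i * x i) * f x =
      stdAddChar k *
        ∑ x ∈ univ.filter (fun x : Fin n → ZMod m => ∑ i, r i * x i = 0), f x := by
    rw [← hr k 0, mul_sum]
    refine sum_congr rfl fun x hx => ?_
    rw [(mem_filter.mp hx).2]
  have h0 : ∑ k : ZMod m, (stdAddChar k : ℂ) = 0 := by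
    simpa using AddChar.sum_eq_zero_of_ne_one (isPrimitive_stdAddChar m (one_ne_zero))
  simp_rw [h]
  rw [← sum_mul, h0, zero_mul]

/-- **Fourier structural collapse.** Let `m` be prime, `n ≥ 1`, and `f : (ZMod m)^n → ℂ` a
function whose sum over each parity class `{x : r·x = k}` is independent of `k`, for every
mask `r` with at least two nonzero coordinates. Then `f` decomposes as a constant plus a sum
of single-digit functions. -/
theorem parity_oblivious_structural_collapse
    (m : ℕ) (hm : Nat.Prime m) [NeZero m] (n : ℕ) (hn : 1 ≤ n)
    (f : (Fin n → ZMod m) → ℂ)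
    (hf : ∀ r : Fin n → ZMod m,
      2 ≤ (Finset.univ.filter fun i => r i ≠ 0).card →
      ∀ k k' : ZMod m,
        ∑ x ∈ Finset.univ.filter (fun x : Fin n → ZMod m => ∑ i, r i * x i = k), f x =
        ∑ x ∈ Finset.univ.filter (fun x : Fin n → ZMod m => ∑ i, r i * x i = k'), f x) :
    ∃ (c : ℂ) (g : Fin n → ZMod m → ℂ),
      ∀ x : Fin n → ZMod m, f x = c + ∑ i, g i (x i) := by
  classical
  set F : (Fin n → ZMod m) → ℂ := fun r =>
    ∑ x : Fin n → ZMod m, ZMod.stdAddChar (∑ i, r i * x i) * f x with hF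
  -- A nonvanishing Fourier coefficient sits at a vector supported on a single coordinate.
  have hsupp (r : Fin n → ZMod m) : ∃ i, F r = 0 ∨ ∀ j, j ≠ i → r j = 0 := by
    by_cases hr : 2 ≤ (univ.filter fun i => r i ≠ 0).card
    · exact ⟨⟨0, hn⟩, Or.inl (fourier_coeff_eq_zero m n hm.one_lt f r (hf r hr))⟩
    · have : Nonempty (Fin n) := ⟨⟨0, hn⟩⟩
      obtain ⟨i, hi⟩ := card_le_one_iff_subset_singleton.mp (by omega :
        (univ.filter fun i => r i ≠ 0).card ≤ 1)
      refine ⟨i, Or.inr fun j hj => ?_⟩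
      by_contra h
      exact hj (mem_singleton.mp (hi (mem_filter.mpr ⟨mem_univ j, h⟩)))
  choose p hp using hsupp
  refine ⟨0, fun i t => ((m : ℂ) ^ n)⁻¹ *
    ∑ r ∈ univ.filter (fun r => p r = i), ZMod.stdAddChar (-(r i * t)) * F r, fun y => ?_⟩
  have hm0 : (m : ℂ) ^ n ≠ 0 := pow_ne_zero _ (NeZero.ne _)
  rw [zero_add, ← mul_sum, eq_inv_mul_iff_mul_eq₀ hm0, ← fourier_inversion_dot,
    ← sum_fiberwise univ p]
  refine sum_congr rfl fun i _ => sum_congr rfl fun r hr => ?_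
  obtain rfl := (mem_filter.mp hr).2
  rcases hp r with h | h
  · simp only [hF] at h ⊢
    rw [h, mul_zero, mul_zero]
  · rw [sum_eq_single (p r) (fun j _ hj => by rw [h j hj, zero_mul]) (by simp)]
end

section
/- Every qubit strategy for the (2,3) parity-oblivious random exclusion code satisfying full parity-obliviousness has success probability at most 2/3 + 1/(3·√2). -/
open Finset
open scoped ComplexOrder

section WeightedVectors

variable {E : Type*} [NormedAddCommGroup E] [InnerProductSpace ℝ E]
variable {ι κ : Type*} [Fintype ι] [Fintype κ]

open scoped InnerProductSpace

/-- Translating a family of weighted mean zero by `e` raises its weighted mean square norm by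
`‖e‖ ^ 2`. -/
lemma sum_weight_mul_norm_add_sq {α : ι → ℝ} (hα : ∑ i, α i = 1) {w : ι → E}
    (hw : ∑ i, α i • w i = 0) (e : E) :
    ∑ i, α i * ‖w i + e‖ ^ 2 = ∑ i, α i * ‖w i‖ ^ 2 + ‖e‖ ^ 2 := by
  have hcross : ∑ i, α i * ⟪w i, e⟫_ℝ = 0 := by
    have := congrArg (fun z => ⟪z, e⟫_ℝ) hw
    simpa [sum_inner, real_inner_smul_left] using this
  calc ∑ i, α i * ‖w i + e‖ ^ 2
      = ∑ i, (α i * ‖w i‖ ^ 2 + 2 * (α i * ⟪w i, e⟫_ℝ) + α i * ‖e‖ ^ 2) := by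
        refine sum_congr rfl fun i _ => ?_
        rw [norm_add_sq_real]; ring
    _ = _ := by
        rw [sum_add_distrib, sum_add_distrib, ← mul_sum, hcross, ← sum_mul, hα]; ring

/-- The weighted variances of two families sum to at most one when all pairwise sums lie in
the unit ball. -/
lemma sum_weight_mul_norm_sub_sq_add_le {α : ι → ℝ} {β : κ → ℝ} (hα0 : ∀ i, 0 ≤ α i)
    (hβ0 : ∀ j, 0 ≤ β j) (hα : ∑ i, α i = 1) (hβ : ∑ j, β j = 1) {u : ι → E} {v : κ → E}
    (huv : ∀ i j, ‖u i + v j‖ ≤ 1) :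
    ∑ i, α i * ‖u i - ∑ k, α k • u k‖ ^ 2 + ∑ j, β j * ‖v j - ∑ k, β k • v k‖ ^ 2 ≤ 1 := by
  set c := ∑ k, α k • u k with hc
  set d := ∑ k, β k • v k with hd
  have hw : ∑ i, α i • (u i - c) = 0 := by
    simp [smul_sub, sum_sub_distrib, ← sum_smul, hα, hc]
  have hz : ∑ j, β j • (v j - d) = 0 := by
    simp [smul_sub, sum_sub_distrib, ← sum_smul, hβ, hd]
  have hrow : ∀ j, ∑ i, α i * ‖u i + v j‖ ^ 2 =
      ∑ i, α i * ‖u i - c‖ ^ 2 + ‖(v j - d) + (c + d)‖ ^ 2 := by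
    intro j
    rw [← sum_weight_mul_norm_add_sq hα hw]
    refine sum_congr rfl fun i _ => ?_
    congr 3; abel
  have hle : ∀ j, ∑ i, α i * ‖u i + v j‖ ^ 2 ≤ 1 := by
    intro j
    rw [← hα]
    refine sum_le_sum fun i _ => mul_le_of_le_one_right (hα0 i) ?_
    exact pow_le_one₀ (norm_nonneg _) (huv i j)
  have htot : ∑ j, β j * ∑ i, α i * ‖u i + v j‖ ^ 2 ≤ 1 := by
    rw [← hβ]
    exact sum_le_sum fun j _ => mul_le_of_le_one_right (hβ0 j) (hle j)
  simp only [hrow, mul_add, sum_add_distrib, ← sum_mul, hβ] at htot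
  rw [sum_weight_mul_norm_add_sq hβ hz] at htot
  nlinarith [sq_nonneg ‖c + d‖]

/-- If `m` has total zero and `‖m i‖ ≤ α i`, then `∑ ⟪u i, m i⟫` is controlled by the
`α`-weighted variance of `u`. -/
lemma neg_sqrt_two_mul_sum_inner_le {α : ι → ℝ} (hα : ∑ i, α i = 1) {m : ι → E}
    (hm : ∑ i, m i = 0) (hmα : ∀ i, ‖m i‖ ≤ α i) (u : ι → E) :
    -(√2 * ∑ i, ⟪u i, m i⟫_ℝ) ≤ ∑ i, α i * ‖u i - ∑ k, α k • u k‖ ^ 2 + 1 / 2 := by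
  set c := ∑ k, α k • u k
  have hshift : ∑ i, ⟪u i, m i⟫_ℝ = ∑ i, ⟪u i - c, m i⟫_ℝ := by
    simp [inner_sub_left, sum_sub_distrib, ← inner_sum, hm]
  have hhalf : (1 / 2 : ℝ) = ∑ i, α i * (1 / 2) := by rw [← sum_mul, hα, one_mul]
  rw [hshift, hhalf, ← sum_add_distrib, mul_sum, ← sum_neg_distrib]
  refine sum_le_sum fun i _ => ?_
  have hα0 : 0 ≤ α i := (norm_nonneg _).trans (hmα i)
  have hcs : -⟪u i - c, m i⟫_ℝ ≤ ‖u i - c‖ * α i :=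
    (neg_le_abs _).trans ((abs_real_inner_le_norm _ _).trans
      (mul_le_mul_of_nonneg_left (hmα i) (norm_nonneg _)))
  have hsq : √2 ^ 2 = (2 : ℝ) := Real.sq_sqrt (by norm_num)
  have hamgm : √2 * ‖u i - c‖ ≤ ‖u i - c‖ ^ 2 + 1 / 2 := by
    nlinarith [sq_nonneg (√2 * ‖u i - c‖ - 1), hsq]
  calc -(√2 * ⟪u i - c, m i⟫_ℝ) = √2 * -⟪u i - c, m i⟫_ℝ := by ring
    _ ≤ √2 * (‖u i - c‖ * α i) := mul_le_mul_of_nonneg_left hcs (Real.sqrt_nonneg _)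
    _ = α i * (√2 * ‖u i - c‖) := by ring
    _ ≤ α i * (‖u i - c‖ ^ 2 + 1 / 2) := mul_le_mul_of_nonneg_left hamgm hα0
    _ = _ := by ring

lemma neg_sqrt_two_le_sum_inner_add_sum_inner {α : ι → ℝ} {β : κ → ℝ} (hα : ∑ i, α i = 1)
    (hβ : ∑ j, β j = 1) {m : ι → E} {n : κ → E} (hm : ∑ i, m i = 0) (hn : ∑ j, n j = 0)
    (hmα : ∀ i, ‖m i‖ ≤ α i) (hnβ : ∀ j, ‖n j‖ ≤ β j) {u : ι → E} {v : κ → E}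
    (huv : ∀ i j, ‖u i + v j‖ ≤ 1) :
    -√2 ≤ ∑ i, ⟪u i, m i⟫_ℝ + ∑ j, ⟪v j, n j⟫_ℝ := by
  have hvar := sum_weight_mul_norm_sub_sq_add_le (fun i => (norm_nonneg _).trans (hmα i))
    (fun j => (norm_nonneg _).trans (hnβ j)) hα hβ huv
  have hu := neg_sqrt_two_mul_sum_inner_le hα hm hmα u
  have hv := neg_sqrt_two_mul_sum_inner_le hβ hn hnβ v
  have hsq : √2 * √2 = (2 : ℝ) := Real.mul_self_sqrt (by norm_num)
  have hpos : (0 : ℝ) < √2 := by positivity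
  refine le_of_mul_le_mul_left ?_ hpos
  linarith

/-- Summing over a product grid, a family that splits additively pairs with zero-sum families
through its two components separately. -/
lemma sum_inner_add_inner_of_additive {m : ι → E} {n : κ → E} (hm : ∑ i, m i = 0)
    (hn : ∑ j, n j = 0) (u : ι → E) (v : κ → E) :
    ∑ x : ι × κ, (⟪u x.1 + v x.2, m x.1⟫_ℝ + ⟪u x.1 + v x.2, n x.2⟫_ℝ) =
      Fintype.card κ * ∑ i, ⟪u i, m i⟫_ℝ + Fintype.card ι * ∑ j, ⟪v j, n j⟫_ℝ := by
  have hvm : ∑ i, ∑ j, ⟪v j, m i⟫_ℝ = 0 := by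
    simp [← sum_inner, ← inner_sum, hm]
  have hun : ∑ i, ∑ j, ⟪u i, n j⟫_ℝ = 0 := by
    simp [← inner_sum, hn]
  simp only [Fintype.sum_prod_type, inner_add_left, sum_add_distrib, hvm, hun]
  simp [mul_sum]

end WeightedVectors

/-- A function on `(ZMod 3)²` whose sums along the lines `x₁ + x₂ = k` do not depend on `k`, and
likewise along `x₁ + 2 x₂ = k`, is a sum of functions of the separate coordinates. -/
lemma exists_additive_split_of_line_sums {V : Type*} [AddCommGroup V] [Module ℝ V]
    (r : ZMod 3 → ZMod 3 → V)
    (h₁ : ∀ k k' : ZMod 3,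
      ∑ x ∈ univ.filter (fun x : ZMod 3 × ZMod 3 => x.1 + x.2 = k), r x.1 x.2 =
      ∑ x ∈ univ.filter (fun x : ZMod 3 × ZMod 3 => x.1 + x.2 = k'), r x.1 x.2)
    (h₂ : ∀ k k' : ZMod 3,
      ∑ x ∈ univ.filter (fun x : ZMod 3 × ZMod 3 => x.1 + 2 * x.2 = k), r x.1 x.2 =
      ∑ x ∈ univ.filter (fun x : ZMod 3 × ZMod 3 => x.1 + 2 * x.2 = k'), r x.1 x.2) :
    ∃ u v : ZMod 3 → V, ∀ i j, r i j = u i + v j := by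
  have f₁ : ∀ k : ZMod 3, univ.filter (fun x : ZMod 3 × ZMod 3 => x.1 + x.2 = k) =
      {(0, k), (1, k + 2), (2, k + 1)} := by decide
  have f₂ : ∀ k : ZMod 3, univ.filter (fun x : ZMod 3 × ZMod 3 => x.1 + 2 * x.2 = k) =
      {(k, 0), (k + 1, 1), (k + 2, 2)} := by decide
  have s₁ : ∀ k : ZMod 3, ∑ x ∈ ({(0, k), (1, k + 2), (2, k + 1)} : Finset (ZMod 3 × ZMod 3)),
      r x.1 x.2 = r 0 k + r 1 (k + 2) + r 2 (k + 1) := by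
    intro k
    rw [sum_insert (by revert k; decide), sum_insert (by revert k; decide), sum_singleton]
    abel
  have s₂ : ∀ k : ZMod 3, ∑ x ∈ ({(k, 0), (k + 1, 1), (k + 2, 2)} : Finset (ZMod 3 × ZMod 3)),
      r x.1 x.2 = r k 0 + r (k + 1) 1 + r (k + 2) 2 := by
    intro k
    rw [sum_insert (by revert k; decide), sum_insert (by revert k; decide), sum_singleton]
    abel
  simp only [f₁, f₂, s₁, s₂] at h₁ h₂
  have e11 : (1 + 1 : ZMod 3) = 2 := by decide
  have e12 : (1 + 2 : ZMod 3) = 0 := by decide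
  have e21 : (2 + 1 : ZMod 3) = 0 := by decide
  have e22 : (2 + 2 : ZMod 3) = 1 := by decide
  have a₁ := h₁ 0 1
  have a₂ := h₁ 0 2
  have b₁ := h₂ 0 1
  have b₂ := h₂ 0 2
  simp only [zero_add, e11, e12, e21, e22] at a₁ a₂ b₁ b₂
  refine ⟨fun i => r i 0, fun j => r 0 j - r 0 0, fun i j => ?_⟩
  have cases3 : ∀ k : ZMod 3, k = 0 ∨ k = 1 ∨ k = 2 := by decide
  rcases cases3 i with rfl | rfl | rfl <;> rcases cases3 j with rfl | rfl | rfl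
  any_goals module
  · linear_combination (norm := module) (2 / 3 : ℝ) • a₁ + (-1 / 3 : ℝ) • a₂ +
      (1 / 3 : ℝ) • b₁ + (1 / 3 : ℝ) • b₂
  · linear_combination (norm := module) (1 / 3 : ℝ) • a₁ + (1 / 3 : ℝ) • a₂ +
      (2 / 3 : ℝ) • b₁ + (-1 / 3 : ℝ) • b₂
  · linear_combination (norm := module) (1 / 3 : ℝ) • a₁ + (1 / 3 : ℝ) • a₂ +
      (-1 / 3 : ℝ) • b₁ + (2 / 3 : ℝ) • b₂
  · linear_combination (norm := module) (-1 / 3 : ℝ) • a₁ + (2 / 3 : ℝ) • a₂ +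
      (1 / 3 : ℝ) • b₁ + (1 / 3 : ℝ) • b₂

section Bloch

/-- The (reflected) Bloch vector of a Hermitian `2 × 2` matrix. -/
noncomputable def blochVector (A : Matrix (Fin 2) (Fin 2) ℂ) : EuclideanSpace ℝ (Fin 3) :=
  !₂[2 * (A 0 1).re, 2 * (A 0 1).im, (A 0 0).re - (A 1 1).re]

lemma blochVector_one : blochVector 1 = 0 := by
  ext i; fin_cases i <;> simp [blochVector]

lemma blochVector_add (A B : Matrix (Fin 2) (Fin 2) ℂ) :
    blochVector (A + B) = blochVector A + blochVector B := by
  ext i; fin_cases i <;> simp [blochVector] <;> ring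

lemma blochVector_sum {ι : Type*} (s : Finset ι) (A : ι → Matrix (Fin 2) (Fin 2) ℂ) :
    blochVector (∑ i ∈ s, A i) = ∑ i ∈ s, blochVector (A i) :=
  map_sum (AddMonoidHom.mk' blochVector blochVector_add) A s

lemma re_trace_mul_eq_bloch {A B : Matrix (Fin 2) (Fin 2) ℂ} (hA : A.IsHermitian)
    (hB : B.IsHermitian) :
    (A * B).trace.re =
      (A.trace.re * B.trace.re + inner ℝ (blochVector A) (blochVector B)) / 2 := by
  have hA10 := hA.apply 1 0
  have hB10 := hB.apply 1 0
  have hA0 := congrArg Complex.im (hA.apply 0 0)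
  have hA1 := congrArg Complex.im (hA.apply 1 1)
  simp only [Complex.star_def, Complex.conj_im] at hA0 hA1
  have hA0' : (A 0 0).im = 0 := by linarith
  have hA1' : (A 1 1).im = 0 := by linarith
  simp [Matrix.trace_fin_two, Matrix.mul_apply, Fin.sum_univ_two, Fin.sum_univ_three,
    PiLp.inner_apply, blochVector, ← hA10, ← hB10, hA0', hA1']
  ring

lemma norm_blochVector_le {A : Matrix (Fin 2) (Fin 2) ℂ} (hA : A.PosSemidef) :
    ‖blochVector A‖ ≤ A.trace.re := by
  have hdet := (Complex.le_def.1 hA.det_nonneg).1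
  have htr := (Complex.le_def.1 hA.trace_nonneg).1
  have hA10 := hA.isHermitian.apply 1 0
  have hA0 := congrArg Complex.im (hA.isHermitian.apply 0 0)
  simp only [Complex.star_def, Complex.conj_im] at hA0
  have hA0' : (A 0 0).im = 0 := by linarith
  rw [EuclideanSpace.norm_eq]
  refine Real.sqrt_le_iff.2 ⟨by simpa using htr, ?_⟩
  simp [Matrix.det_fin_two, ← hA10, hA0'] at hdet
  simp [Matrix.trace_fin_two, Fin.sum_univ_three, blochVector]
  nlinarith

/-- Excluding one outcome of a POVM, in Bloch form. -/
lemma sum_ne_re_trace_mul_eq {ι : Type*} [Fintype ι] [DecidableEq ι]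
    {ρ : Matrix (Fin 2) (Fin 2) ℂ} (hρ : ρ.IsHermitian) (hρ_tr : ρ.trace = 1)
    {M : ι → Matrix (Fin 2) (Fin 2) ℂ} (hM : ∀ b, (M b).IsHermitian) (hsum : ∑ b, M b = 1)
    (a : ι) :
    ∑ b ∈ univ.filter (fun b => b ≠ a), (ρ * M b).trace.re =
      1 - (M a).trace.re / 2 -
        inner ℝ (blochVector ρ) ((1 / 2 : ℝ) • blochVector (M a)) := by
  have htot : ∑ b, (ρ * M b).trace.re = 1 := by
    rw [← Complex.re_sum, ← Matrix.trace_sum, ← Matrix.mul_sum, hsum, mul_one, hρ_tr,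
      Complex.one_re]
  have hsplit := add_sum_erase univ (fun b => (ρ * M b).trace.re) (mem_univ a)
  have hfilter : univ.filter (fun b => b ≠ a) = univ.erase a := by
    ext b; simp
  rw [hfilter, real_inner_smul_right]
  have ha := re_trace_mul_eq_bloch hρ (hM a)
  rw [hρ_tr, Complex.one_re] at ha
  linarith

lemma sum_smul_blochVector_eq_zero {ι : Type*} [Fintype ι]
    {M : ι → Matrix (Fin 2) (Fin 2) ℂ} (hsum : ∑ b, M b = 1) :
    ∑ b, (1 / 2 : ℝ) • blochVector (M b) = 0 := by
  rw [← smul_sum, ← blochVector_sum, hsum, blochVector_one, smul_zero]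

lemma sum_half_re_trace_eq_one {ι : Type*} [Fintype ι]
    {M : ι → Matrix (Fin 2) (Fin 2) ℂ} (hsum : ∑ b, M b = 1) :
    ∑ b, (M b).trace.re / 2 = 1 := by
  rw [← sum_div, ← Complex.re_sum, ← Matrix.trace_sum, hsum]
  simp

lemma norm_half_smul_blochVector_le {A : Matrix (Fin 2) (Fin 2) ℂ} (hA : A.PosSemidef) :
    ‖(1 / 2 : ℝ) • blochVector A‖ ≤ A.trace.re / 2 := by
  rw [norm_smul, Real.norm_of_nonneg (by norm_num)]
  linarith [norm_blochVector_le hA]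

end Bloch

/-- **Exact qubit optimum for the (2,3) POREC (upper bound).** Every qubit strategy
(states `ρ x₁ x₂` and POVMs `M₁, M₂`) for the `(2,3)` parity-oblivious random exclusion code
satisfying full parity-obliviousness (for the masks `(1,1)` and `(1,2)`) has success
probability at most `2/3 + 1/(3√2)`. -/
theorem porec23_qubit_bound
    (ρ : ZMod 3 → ZMod 3 → Matrix (Fin 2) (Fin 2) ℂ)
    (hρ_psd : ∀ x₁ x₂, (ρ x₁ x₂).PosSemidef)
    (hρ_tr : ∀ x₁ x₂, (ρ x₁ x₂).trace = 1)
    (M₁ M₂ : ZMod 3 → Matrix (Fin 2) (Fin 2) ℂ)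
    (hM₁_psd : ∀ b, (M₁ b).PosSemidef) (hM₂_psd : ∀ b, (M₂ b).PosSemidef)
    (hM₁_sum : ∑ b : ZMod 3, M₁ b = 1) (hM₂_sum : ∑ b : ZMod 3, M₂ b = 1)
    (hPO₁ : ∀ k k' : ZMod 3,
      ∑ x ∈ Finset.univ.filter (fun x : ZMod 3 × ZMod 3 => x.1 + x.2 = k), ρ x.1 x.2 =
      ∑ x ∈ Finset.univ.filter (fun x : ZMod 3 × ZMod 3 => x.1 + x.2 = k'), ρ x.1 x.2)
    (hPO₂ : ∀ k k' : ZMod 3,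
      ∑ x ∈ Finset.univ.filter (fun x : ZMod 3 × ZMod 3 => x.1 + 2 * x.2 = k), ρ x.1 x.2 =
      ∑ x ∈ Finset.univ.filter (fun x : ZMod 3 × ZMod 3 => x.1 + 2 * x.2 = k'), ρ x.1 x.2) :
    (1 / 18 : ℝ) *
        ∑ x : ZMod 3 × ZMod 3,
          ((∑ b ∈ Finset.univ.filter (fun b => b ≠ x.1), ((ρ x.1 x.2 * M₁ b).trace).re) +
           (∑ b ∈ Finset.univ.filter (fun b => b ≠ x.2), ((ρ x.1 x.2 * M₂ b).trace).re))
      ≤ 2 / 3 + 1 / (3 * Real.sqrt 2) := by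
  obtain ⟨u, v, huv⟩ := exists_additive_split_of_line_sums (fun i j => blochVector (ρ i j))
    (fun k k' => by simpa only [blochVector_sum] using congrArg blochVector (hPO₁ k k'))
    (fun k k' => by simpa only [blochVector_sum] using congrArg blochVector (hPO₂ k k'))
  have hball : ∀ i j, ‖u i + v j‖ ≤ 1 := fun i j => by
    rw [← huv]
    simpa [hρ_tr] using norm_blochVector_le (hρ_psd i j)
  have hm := sum_smul_blochVector_eq_zero hM₁_sum
  have hn := sum_smul_blochVector_eq_zero hM₂_sum
  have hα := sum_half_re_trace_eq_one hM₁_sum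
  have hβ := sum_half_re_trace_eq_one hM₂_sum
  have hbound := neg_sqrt_two_le_sum_inner_add_sum_inner hα hβ hm hn
    (fun b => norm_half_smul_blochVector_le (hM₁_psd b))
    (fun b => norm_half_smul_blochVector_le (hM₂_psd b)) hball
  have hgrid := sum_inner_add_inner_of_additive hm hn u v
  have hvalue : ∑ x : ZMod 3 × ZMod 3,
      ((∑ b ∈ Finset.univ.filter (fun b => b ≠ x.1), ((ρ x.1 x.2 * M₁ b).trace).re) +
       (∑ b ∈ Finset.univ.filter (fun b => b ≠ x.2), ((ρ x.1 x.2 * M₂ b).trace).re)) =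
      12 - ∑ x : ZMod 3 × ZMod 3,
        (inner ℝ (u x.1 + v x.2) ((1 / 2 : ℝ) • blochVector (M₁ x.1)) +
          inner ℝ (u x.1 + v x.2) ((1 / 2 : ℝ) • blochVector (M₂ x.2))) := by
    have hweights : ∑ x : ZMod 3 × ZMod 3,
        (2 - (M₁ x.1).trace.re / 2 - (M₂ x.2).trace.re / 2) = 12 := by
      simp only [Fintype.sum_prod_type, sum_sub_distrib, hβ, sum_const, card_univ, ZMod.card,
        ← smul_sum, hα]
      norm_num
    rw [← hweights, ← sum_sub_distrib]
    refine sum_congr rfl fun x _ => ?_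
    rw [sum_ne_re_trace_mul_eq (hρ_psd _ _).isHermitian (hρ_tr _ _)
        (fun b => (hM₁_psd b).isHermitian) hM₁_sum,
      sum_ne_re_trace_mul_eq (hρ_psd _ _).isHermitian (hρ_tr _ _)
        (fun b => (hM₂_psd b).isHermitian) hM₂_sum, ← huv]
    ring
  have hsqrt : 1 / (3 * √2) = √2 / 6 := by
    have hsq : √2 * √2 = (2 : ℝ) := Real.mul_self_sqrt (by norm_num)
    rw [div_eq_div_iff (by positivity) (by norm_num)]
    linarith
  rw [hvalue, hgrid, hsqrt, ZMod.card]
  push_cast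
  linarith
end
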